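/- Let A be an n×n real matrix all of whose eigenvalues have strictly negative real part, let b, c ∈ ℝⁿ, let γ > 0, and let φ be an n×n symmetric positive definite real matrix. Suppose that for every ω ∈ ℝ, Re( γ/2 + cᵀ (iω I − A)⁻¹ b ) > 0 (the matrix iωI − A is invertible since A has no purely imaginary eigenvalues). Then there exist ε > 0, a vector α ∈ ℝⁿ, and a symmetric positive definite n×n real matrix P such that Aᵀ P + P A = −α αᵀ − ε φ and P b − c = √γ α. -/

import Mathlib

open Matrix

namespace MKY
open Polynomial

lemma factor (f : ℝ[X]) (hf : f ≠ 0) (h : ∀ z : ℂ, aeval z f = 0 → z.re ≠ 0) :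
    ∃ p q : ℝ[X], f = p * q ∧ (∀ z : ℂ, aeval z p = 0 → z.re < 0) ∧
      (∀ z : ℂ, aeval z q = 0 → 0 < z.re) := by
  induction f using UniqueFactorizationMonoid.induction_on_prime with
  | h₁ => exact absurd rfl hf
  | h₂ u hu =>
    refine ⟨u, 1, by simp, ?_, by simp⟩
    intro z hz
    exfalso
    have := hu.map (aeval z)
    rw [hz] at this
    exact not_isUnit_zero this
  | h₃ a d ha hd ih =>
    obtain ⟨p, q, hpq, hp, hq⟩ := ih ha (fun z hz => h z (by simp [hz]))
    have key : ∀ z w : ℂ, aeval z d = 0 → aeval w d = 0 → w.re = z.re := by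
      intro z w hz hw
      by_cases him : z.im = 0
      · have hzr : z = (algebraMap ℝ ℂ) z.re := by
          apply Complex.ext <;> simp [him]
        have hdv : (X - C z.re) ∣ d := by
          rw [dvd_iff_isRoot, IsRoot.def]
          rw [hzr, aeval_algebraMap_apply] at hz
          have := Complex.ofReal_injective (a₁ := aeval z.re d) (a₂ := 0) (by simpa using hz)
          simpa [aeval_def] using this
        have hass : Associated (X - C z.re) d :=
          (irreducible_X_sub_C z.re).associated_of_dvd hd.irreducible hdv
        obtain ⟨e, he⟩ := hass.symm.dvd
        have : aeval w (X - C z.re) = 0 := by rw [he]; simp [hw]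
        simp at this
        have h2 := congrArg Complex.re this
        simp at h2
        linarith
      · have hdv := d.quadratic_dvd_of_aeval_eq_zero_im_ne_zero hz him
        set qd := (X ^ 2 - C (2 * z.re) * X + C (‖z‖ ^ 2) : ℝ[X]) with hqd
        have hnu : ¬ IsUnit qd := by
          intro hu
          have h1 := hu.map (aeval z)
          have h0 : aeval z qd = 0 := by
            rw [hqd]
            apply Complex.ext
            · have := Complex.sq_norm z
              rw [Complex.normSq_apply] at this
              simp [pow_two] at this ⊢
              linarith
            · simp [pow_two]
              ring
          rw [h0] at h1
          exact not_isUnit_zero h1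
        obtain ⟨e, he⟩ := hdv
        have hue : IsUnit e := (hd.irreducible.isUnit_or_isUnit he).resolve_left hnu
        have hew : aeval w e ≠ 0 := (hue.map (aeval w)).ne_zero
        have hw2 : aeval w qd = 0 := by
          rw [he, map_mul] at hw
          exact (mul_eq_zero.mp hw).resolve_right hew
        have h3 : (w - z) * (w - (starRingEnd ℂ) z) = 0 := by
          rw [← hw2, hqd]
          have h5 : z + (starRingEnd ℂ) z = ((2 * z.re : ℝ) : ℂ) := Complex.add_conj z
          have h6 : z * (starRingEnd ℂ) z = ((‖z‖ ^ 2 : ℝ) : ℂ) := by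
            rw [Complex.mul_conj, Complex.sq_norm]
          simp only [map_add, map_sub, map_mul, map_pow, aeval_X, aeval_C]
          simp only [Complex.coe_algebraMap]
          simp only [← Complex.ofReal_pow, ← Complex.ofReal_mul]
          rw [← h5, ← h6]; ring
        rcases mul_eq_zero.mp h3 with h4 | h4
        · rw [sub_eq_zero.mp h4]
        · rw [sub_eq_zero.mp h4]; simp
    by_cases hneg : ∀ z : ℂ, aeval z d = 0 → z.re < 0
    · refine ⟨d * p, q, by rw [hpq]; ring, ?_, hq⟩
      intro z hz
      rw [map_mul] at hz
      rcases mul_eq_zero.mp hz with hz | hz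
      exacts [hneg z hz, hp z hz]
    · push Not at hneg
      obtain ⟨z, hz, hz0⟩ := hneg
      refine ⟨p, d * q, by rw [hpq]; ring, hp, ?_⟩
      intro w hw
      rw [map_mul] at hw
      rcases mul_eq_zero.mp hw with hw | hw
      · rw [key z w hz hw]
        exact lt_of_le_of_ne hz0 (h z (by simp [hz])).symm
      · exact hq w hw

lemma coprime_of {p q : ℝ[X]} (h : ∀ z : ℂ, aeval z p = 0 → aeval z q = 0 → False) :
    IsCoprime p q := by
  refine (Polynomial.isCoprime_iff_aeval_ne_zero_of_isAlgClosed ℝ ℂ p q).mpr ?_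
  intro a
  by_contra hc
  push Not at hc
  exact h a hc.1 hc.2
open Filter Topology

section
attribute [local instance] Matrix.linftyOpNormedRing Matrix.linftyOpNormedAlgebra

lemma det_ne {n : ℕ} (A : Matrix (Fin n) (Fin n) ℝ) 
    (hH : ∀ μ : ℂ, ((A.map (algebraMap ℝ ℂ)).charpoly).IsRoot μ → μ.re < 0) (μ : ℂ) (hμ : 0 ≤ μ.re) :
    (μ • (1 : Matrix (Fin n) (Fin n) ℂ) - A.map (algebraMap ℝ ℂ)).det ≠ 0 := by
  intro h
  have : ((A.map (algebraMap ℝ ℂ)).charpoly).IsRoot μ := by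
    rw [Polynomial.IsRoot.def, Matrix.eval_charpoly, ← h, Matrix.scalar_apply, Matrix.smul_one_eq_diagonal]
  linarith [hH μ this]

lemma resolvent_zero {n : ℕ} (A : Matrix (Fin n) (Fin n) ℂ) :
    Tendsto (fun ω : ℝ => ((Complex.I * (ω : ℂ)) • (1 : Matrix (Fin n) (Fin n) ℂ) - A)⁻¹)
      (cocompact ℝ) (𝓝 0) := by
  have h1 := spectrum.resolvent_tendsto_cobounded (𝕜 := ℂ) A
  have h2 : Tendsto (fun ω : ℝ => Complex.I * (ω : ℂ)) (cocompact ℝ) (Bornology.cobounded ℂ) := by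
    rw [← tendsto_norm_atTop_iff_cobounded]
    refine (tendsto_norm_cocompact_atTop (E := ℝ)).congr ?_
    intro ω
    simp
  refine (h1.comp h2).congr ?_
  intro ω
  rw [Matrix.nonsing_inv_eq_ringInverse]
  simp [resolvent, Algebra.algebraMap_eq_smul_one]

lemma pow_tendsto {n : ℕ} (T : Matrix (Fin n) (Fin n) ℂ) (h : ∀ z ∈ spectrum ℂ T, ‖z‖ < 1) :
    Tendsto (fun k : ℕ => T ^ k) atTop (𝓝 0) := by
  rcases Nat.eq_zero_or_pos n with rfl | hn
  · have : (fun k : ℕ => T ^ k) = fun _ => 0 := by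
      funext k; exact Subsingleton.elim _ _
    rw [this]; exact tendsto_const_nhds
  have : Nonempty (Fin n) := ⟨⟨0, hn⟩⟩
  have hr : spectralRadius ℂ T < (1 : NNReal) :=
    spectrum.spectralRadius_lt_of_forall_lt T (fun z hz => by exact_mod_cast h z hz)
  obtain ⟨r, hr1, hr2⟩ := ENNReal.lt_iff_exists_nnreal_btwn.mp hr
  have hg := spectrum.pow_nnnorm_pow_one_div_tendsto_nhds_spectralRadius T
  have hev := hg.eventually (gt_mem_nhds hr1)
  have hr3 : (r : ℝ) < 1 := by exact_mod_cast hr2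
  refine squeeze_zero_norm' (a := fun k => (r : ℝ) ^ k) ?_
    (tendsto_pow_atTop_nhds_zero_of_lt_one r.2 hr3)
  filter_upwards [hev, eventually_gt_atTop 0] with k hk hk0
  have h3 : (‖T ^ k‖₊ : ENNReal) ≤ (r : ENNReal) ^ k := by
    have := ENNReal.rpow_le_rpow hk.le (z := (k : ℝ)) (by positivity)
    rw [← ENNReal.rpow_mul, one_div, inv_mul_cancel₀ (by positivity), ENNReal.rpow_one,
      ENNReal.rpow_natCast] at this
    exact this
  have h4 : ‖T ^ k‖₊ ≤ r ^ k := by exact_mod_cast h3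
  exact_mod_cast h4

end

lemma exists_eps {n : ℕ} (A : Matrix (Fin n) (Fin n) ℝ) (b c : Fin n → ℝ)
    (γ : ℝ) (hγ : 0 < γ) (φ : Matrix (Fin n) (Fin n) ℝ)
    (hH : ∀ μ : ℂ, ((A.map (algebraMap ℝ ℂ)).charpoly).IsRoot μ → μ.re < 0)
    (hSPR : ∀ ω : ℝ,
      0 < ((γ : ℂ) / 2 + (fun i => (c i : ℂ)) ⬝ᵥ
        (((Complex.I * (ω : ℂ)) • (1 : Matrix (Fin n) (Fin n) ℂ)
            - A.map (algebraMap ℝ ℂ))⁻¹.mulVec (fun i => (b i : ℂ)))).re) :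
    ∃ ε > (0 : ℝ), ∀ ω : ℝ, ∀ x : Fin n → ℂ, x = (((Complex.I * (ω : ℂ)) • (1 : Matrix (Fin n) (Fin n) ℂ)
            - A.map (algebraMap ℝ ℂ))⁻¹.mulVec (fun i => (b i : ℂ))) →
      ε * (star x ⬝ᵥ (φ.map (algebraMap ℝ ℂ) *ᵥ x)).re < 
        γ + 2 * ((fun i => (c i : ℂ)) ⬝ᵥ x).re := by
  set x : ℝ → Fin n → ℂ := fun ω => (((Complex.I * (ω : ℂ)) • (1 : Matrix (Fin n) (Fin n) ℂ)
            - A.map (algebraMap ℝ ℂ))⁻¹.mulVec (fun i => (b i : ℂ))) with hx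
  have hcont : Continuous x := by
    have hM : Continuous (fun ω : ℝ => (Complex.I * (ω : ℂ)) • (1 : Matrix (Fin n) (Fin n) ℂ)
            - A.map (algebraMap ℝ ℂ)) := by fun_prop
    refine Continuous.matrix_mulVec ?_ continuous_const
    simp only [Matrix.inv_def, Ring.inverse_eq_inv']
    refine Continuous.smul (Continuous.inv₀ hM.matrix_det ?_) hM.matrix_adjugate
    intro ω
    exact det_ne A hH _ (by simp)
  have hzero : Tendsto x (cocompact ℝ) (𝓝 0) := by
    have hc : Continuous (fun M : Matrix (Fin n) (Fin n) ℂ => M *ᵥ (fun i => (b i : ℂ))) := 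
      Continuous.matrix_mulVec continuous_id continuous_const
    have := (hc.tendsto 0).comp (resolvent_zero (A.map (algebraMap ℝ ℂ)))
    rw [Matrix.zero_mulVec] at this
    exact this
  have hf1 : Continuous (fun v : Fin n → ℂ => (star v ⬝ᵥ (φ.map (algebraMap ℝ ℂ) *ᵥ v)).re) := by
    refine Complex.continuous_re.comp (Continuous.dotProduct continuous_star (Continuous.matrix_mulVec continuous_const continuous_id))
  have hf2 : Continuous (fun v : Fin n → ℂ => γ + 2 * ((fun i => (c i : ℂ)) ⬝ᵥ v).re) := by
    refine continuous_const.add (continuous_const.mul (Complex.continuous_re.comp (Continuous.dotProduct continuous_const continuous_id)))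
  have hpos : ∀ ω, 0 < γ + 2 * ((fun i => (c i : ℂ)) ⬝ᵥ x ω).re := by
    intro ω
    have := hSPR ω
    rw [Complex.add_re] at this
    have h2 : ((γ : ℂ) / 2).re = γ / 2 := by simp
    rw [h2] at this
    simp only [hx]
    linarith
  set r : ℝ → ℝ := fun ω => (star (x ω) ⬝ᵥ (φ.map (algebraMap ℝ ℂ) *ᵥ x ω)).re / (γ + 2 * ((fun i => (c i : ℂ)) ⬝ᵥ x ω).re) with hr
  have hrc : Continuous r := (hf1.comp hcont).div (hf2.comp hcont) (fun ω => (hpos ω).ne')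
  have hr0 : Tendsto r (cocompact ℝ) (𝓝 0) := by
    have h1 := (hf1.tendsto 0).comp hzero
    have h2 := (hf2.tendsto 0).comp hzero
    have := h1.div h2 (by simp [hγ.ne'])
    simp only [dotProduct_zero, mulVec_zero, Complex.zero_re, zero_div] at this
    exact this
  obtain ⟨M, hM0, hM⟩ : ∃ M > 0, ∀ ω, r ω ≤ M := by
    have hev := hr0.eventually (gt_mem_nhds (show (0:ℝ) < 1 by norm_num))
    obtain ⟨K, hK, hKs⟩ := mem_cocompact.mp hev
    obtain ⟨B, hB⟩ := hK.bddAbove_image hrc.continuousOn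
    refine ⟨max 1 B, by positivity, fun ω => ?_⟩
    by_cases hω : ω ∈ K
    · exact (hB ⟨ω, hω, rfl⟩).trans (le_max_right _ _)
    · exact (le_of_lt (hKs hω)).trans (le_max_left _ _)
  refine ⟨1 / (2 * M), by positivity, ?_⟩
  rintro ω y rfl
  have h1 := hM ω
  have h2 := hpos ω
  rw [hr] at h1
  simp only [div_le_iff₀ h2] at h1
  change 1 / (2 * M) * (star (x ω) ⬝ᵥ (φ.map (algebraMap ℝ ℂ) *ᵥ x ω)).re < (γ + 2 * ((fun i => (c i : ℂ)) ⬝ᵥ x ω).re)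
  rw [div_mul_eq_mul_div, div_lt_iff₀ (by positivity)]
  nlinarith

lemma lyap {n : ℕ} (A P M : Matrix (Fin n) (Fin n) ℝ)
    (hH : ∀ μ : ℂ, ((A.map (algebraMap ℝ ℂ)).charpoly).IsRoot μ → μ.re < 0)
    (hP : Pᵀ = P) (hM : M.PosDef) (h : Aᵀ * P + P * A = -M) : P.PosDef := by
  set Ac := A.map (algebraMap ℝ ℂ) with hAc
  have hmap : ∀ B : Matrix (Fin n) (Fin n) ℝ, B.map (algebraMap ℝ ℂ) = (algebraMap ℝ ℂ).mapMatrix B :=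
    fun B => rfl
  have hdetc : (1 - Ac).det ≠ 0 := by
    have := det_ne A hH 1 (by simp)
    rwa [one_smul] at this
  have hdet : (1 - A).det ≠ 0 := by
    intro h0
    apply hdetc
    have : (1 - Ac) = (algebraMap ℝ ℂ).mapMatrix (1 - A) := by
      rw [map_sub, map_one, hAc, hmap]
    rw [this, ← RingHom.map_det, h0, map_zero]
  have hu : IsUnit (1 - A).det := isUnit_iff_ne_zero.mpr hdet
  set B := (1 - A)⁻¹ with hB
  have hB1 : (1 - A) * B = 1 := Matrix.mul_nonsing_inv _ hu
  set T := (1 + A) * B with hT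
  set Bc := B.map (algebraMap ℝ ℂ) with hBc
  have hBc1 : (1 - Ac) * Bc = 1 := by
    have := congrArg (algebraMap ℝ ℂ).mapMatrix hB1
    rw [map_mul, map_sub, map_one] at this
    exact this
  set Tc := T.map (algebraMap ℝ ℂ) with hTc
  have hTc1 : Tc = (1 + Ac) * Bc := by
    have : (algebraMap ℝ ℂ).mapMatrix ((1 + A) * B) =
        (1 + (algebraMap ℝ ℂ).mapMatrix A) * (algebraMap ℝ ℂ).mapMatrix B := by
      rw [map_mul, map_add, map_one]
    exact this
  have hspec : ∀ z ∈ spectrum ℂ Tc, ‖z‖ < 1 := by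
    intro z hz
    rw [Matrix.mem_spectrum_iff_isRoot_charpoly, Polynomial.IsRoot.def, Matrix.eval_charpoly,
      ← Matrix.exists_mulVec_eq_zero_iff] at hz
    obtain ⟨v, hv, hzv⟩ := hz
    by_contra hlt
    push Not at hlt
    set w := Bc *ᵥ v with hw
    have hvw : v = w - Ac *ᵥ w := by
      have : (1 - Ac) *ᵥ w = v := by rw [hw, Matrix.mulVec_mulVec, hBc1, Matrix.one_mulVec]
      rw [← this, Matrix.sub_mulVec, Matrix.one_mulVec]
    have hTv : Tc *ᵥ v = w + Ac *ᵥ w := by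
      rw [hTc1, ← Matrix.mulVec_mulVec, ← hw, Matrix.add_mulVec, Matrix.one_mulVec]
    have h1 : z • v = Tc *ᵥ v := by
      rw [Matrix.sub_mulVec, sub_eq_zero] at hzv
      rw [← hzv, Matrix.scalar_apply, ← Matrix.smul_one_eq_diagonal, Matrix.smul_mulVec, Matrix.one_mulVec]
    rw [hTv] at h1
    have h2 : (z + 1) • (Ac *ᵥ w) = (z - 1) • w := by
      rw [hvw] at h1
      rw [smul_sub] at h1
      rw [add_smul, sub_smul, one_smul, one_smul]
      rw [sub_eq_iff_eq_add] at h1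
      rw [h1]; abel
    have hw0 : w ≠ 0 := by
      intro h0
      apply hv
      rw [hvw, h0]; simp
    have hz1 : z + 1 ≠ 0 := by
      intro h0
      rw [h0, zero_smul] at h2
      have : z - 1 ≠ 0 := by
        intro h3
        have h4 : (2 : ℂ) = 0 := by linear_combination h0 - h3
        norm_num at h4
      exact hw0 ((smul_eq_zero.mp h2.symm).resolve_left this)
    have hA : Ac *ᵥ w = ((z - 1) / (z + 1)) • w := by
      rw [div_eq_inv_mul, mul_smul, ← h2, smul_smul, inv_mul_cancel₀ hz1, one_smul]
    refine det_ne A hH ((z - 1) / (z + 1)) ?_ ?_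
    · rw [Complex.div_re, ← add_div]
      apply div_nonneg _ (Complex.normSq_nonneg _)
      have : 1 ≤ ‖z‖ ^ 2 := by nlinarith
      rw [Complex.sq_norm, Complex.normSq_apply] at this
      simp
      nlinarith
    · rw [← Matrix.exists_mulVec_eq_zero_iff]
      refine ⟨w, hw0, ?_⟩
      rw [Matrix.sub_mulVec, ← hAc, hA, Matrix.smul_mulVec, Matrix.one_mulVec, sub_self]
  have hTk : Tendsto (fun k : ℕ => T ^ k) atTop (𝓝 0) := by
    have h1 := pow_tendsto Tc hspec
    have hc : Continuous (fun X : Matrix (Fin n) (Fin n) ℂ => X.map Complex.re) :=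
      Continuous.matrix_map continuous_id Complex.continuous_re
    have h2 := (hc.tendsto 0).comp h1
    have h3 : (0 : Matrix (Fin n) (Fin n) ℂ).map Complex.re = 0 := by ext; simp
    rw [h3] at h2
    refine h2.congr ?_
    intro k
    have : Tc ^ k = (T ^ k).map (algebraMap ℝ ℂ) := by
      rw [hTc, hmap, hmap, map_pow]
    simp only [Function.comp, this]
    ext i j
    simp
  set q : (Fin n → ℝ) → ℝ := fun x => x ⬝ᵥ (P *ᵥ x) with hq
  have hqc : Continuous q := Continuous.dotProduct continuous_id (Continuous.matrix_mulVec continuous_const continuous_id)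
  have hstep : ∀ x, q (T *ᵥ x) - q x = -2 * ((B *ᵥ x) ⬝ᵥ (M *ᵥ (B *ᵥ x))) := by
    intro x
    set w := B *ᵥ x with hw
    have hxw : x = w - A *ᵥ w := by
      have : (1 - A) *ᵥ w = x := by rw [hw, Matrix.mulVec_mulVec, hB1, Matrix.one_mulVec]
      rw [← this, Matrix.sub_mulVec, Matrix.one_mulVec]
    have hTx : T *ᵥ x = w + A *ᵥ w := by
      rw [hT, ← Matrix.mulVec_mulVec, ← hw, Matrix.add_mulVec, Matrix.one_mulVec]
    have hMw : w ⬝ᵥ (M *ᵥ w) = -((A *ᵥ w) ⬝ᵥ (P *ᵥ w)) - w ⬝ᵥ (P *ᵥ (A *ᵥ w)) := by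
      have : M = -(Aᵀ * P + P * A) := by rw [h, neg_neg]
      rw [this, Matrix.neg_mulVec, Matrix.add_mulVec, dotProduct_neg, dotProduct_add,
        ← Matrix.mulVec_mulVec, ← Matrix.mulVec_mulVec, Matrix.dotProduct_mulVec w Aᵀ,
        Matrix.vecMul_transpose]
      ring
    rw [hTx, hMw]
    simp only [hq]
    rw [hxw]
    simp only [Matrix.mulVec_add, Matrix.mulVec_sub, dotProduct_add, dotProduct_sub, add_dotProduct, sub_dotProduct]
    ring
  have hMpos : ∀ w : Fin n → ℝ, w ≠ 0 → 0 < w ⬝ᵥ (M *ᵥ w) := by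
    intro w hw
    simpa using hM.dotProduct_mulVec_pos hw
  have hmono : ∀ x, q (T *ᵥ x) ≤ q x := by
    intro x
    have := hstep x
    by_cases hx : B *ᵥ x = 0
    · rw [hx] at this; simp at this; linarith
    · have := hMpos _ hx; linarith
  have hnonneg : ∀ x, 0 ≤ q x := by
    intro x
    have h1 : ∀ k : ℕ, q ((T ^ k) *ᵥ x) ≤ q x := by
      intro k
      induction k with
      | zero => simp
      | succ k ih =>
        rw [pow_succ', ← Matrix.mulVec_mulVec]
        exact (hmono _).trans ih
    have h2 : Tendsto (fun k : ℕ => q ((T ^ k) *ᵥ x)) atTop (𝓝 0) := by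
      have hc : Continuous (fun X : Matrix (Fin n) (Fin n) ℝ => q (X *ᵥ x)) :=
        hqc.comp (Continuous.matrix_mulVec continuous_id continuous_const)
      have := (hc.tendsto 0).comp hTk
      have h0 : q ((0 : Matrix (Fin n) (Fin n) ℝ) *ᵥ x) = 0 := by simp [hq]
      rw [h0] at this
      exact this
    exact le_of_tendsto' h2 h1
  rw [Matrix.posDef_iff_dotProduct_mulVec]
  refine ⟨by rw [Matrix.IsHermitian, Matrix.conjTranspose_eq_transpose_of_trivial, hP], ?_⟩
  intro x hx
  have hBx : B *ᵥ x ≠ 0 := by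
    intro h0
    apply hx
    rw [← Matrix.one_mulVec x, ← hB1, ← Matrix.mulVec_mulVec, h0, Matrix.mulVec_zero]
  have h1 := hMpos _ hBx
  have h2 := hstep x
  have h3 := hnonneg (T *ᵥ x)
  have : 0 < q x := by linarith
  simpa using this
section
open Polynomial


lemma skew_aeval {E : Type*} [AddCommGroup E] [Module ℝ E] (T : Module.End ℝ E)
    (σ : E →ₗ[ℝ] E →ₗ[ℝ] ℝ) (hs : ∀ z w, σ (T z) w = - σ z (T w)) (p : ℝ[X]) (z w : E) :
    σ (aeval T p z) w = σ z (aeval (-T) p w) := by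
  induction p using Polynomial.induction_on' with
  | add p q hp hq => simp [hp, hq]
  | monomial k a =>
    simp only [aeval_monomial]
    have : ∀ (k : ℕ) (z w : E), σ ((T ^ k) z) w = σ z (((-T) ^ k) w) := by
      intro k
      induction k with
      | zero => simp
      | succ k ih =>
        intro z w
        rw [pow_succ, Module.End.mul_apply, ih, hs, pow_succ', Module.End.mul_apply]
        simp
    simp [Module.algebraMap_end_apply, this]

lemma isotropic {E : Type*} [AddCommGroup E] [Module ℝ E] (T : Module.End ℝ E)
    (σ : E →ₗ[ℝ] E →ₗ[ℝ] ℝ) (hs : ∀ z w, σ (T z) w = - σ z (T w)) (p : ℝ[X])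
    (hp : IsCoprime p (p.comp (-X))) (z w : E) (hz : aeval T p z = 0) (hw : aeval T p w = 0) :
    σ z w = 0 := by
  obtain ⟨u, v, huv⟩ := hp
  have h1 := congrArg (fun r : ℝ[X] => aeval T r w) huv
  simp only [map_add, map_mul, map_one, LinearMap.add_apply, Module.End.mul_apply, hw, map_zero,
    zero_add, Module.End.one_apply] at h1
  have h2 : aeval T (p.comp (-X)) = aeval (-T) p := by
    rw [aeval_comp]; simp
  have h3 : aeval T v (aeval T (p.comp (-X)) w) = aeval T (p.comp (-X)) (aeval T v w) := by
    rw [← Module.End.mul_apply, ← Module.End.mul_apply, ← map_mul, ← map_mul, mul_comm]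
  rw [← h1, h3, h2, ← skew_aeval T σ hs, hz]
  simp

lemma isotropic_finrank {E : Type*} [AddCommGroup E] [Module ℝ E] [FiniteDimensional ℝ E]
    (σ : E →ₗ[ℝ] E →ₗ[ℝ] ℝ) (hinj : Function.Injective σ) (V : Submodule ℝ E)
    (hV : ∀ z ∈ V, ∀ w ∈ V, σ z w = 0) : 2 * Module.finrank ℝ V ≤ Module.finrank ℝ E := by
  have h1 : V.map σ ≤ V.dualAnnihilator := by
    rintro _ ⟨z, hz, rfl⟩
    rw [Submodule.mem_dualAnnihilator]
    exact fun w hw => hV z hz w hw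
  have h2 := Submodule.finrank_mono h1
  rw [← (Submodule.equivMapOfInjective σ hinj V).finrank_eq] at h2
  have h4 : Module.finrank ℝ V ≤ Module.finrank ℝ V.dualAnnihilator := h2
  have h3 := Subspace.finrank_add_finrank_dualAnnihilator_eq V
  omega

lemma coprime_neg {p : ℝ[X]} (h : ∀ z w : ℂ, aeval z p = 0 → aeval w p = 0 → 0 < z.re * w.re) :
    IsCoprime p (p.comp (-X)) := by
  refine coprime_of fun z h1 h2 => ?_
  have h3 : aeval (-z) p = 0 := by
    rw [aeval_comp] at h2
    simpa using h2
  have := h _ _ h1 h3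
  simp at this
  nlinarith [mul_self_nonneg z.re]

variable {K : Type*} [Field K] {n : ℕ}

def Ham (A Q : Matrix (Fin n) (Fin n) K) (b c : Fin n → K) (g : K) :
    Matrix (Fin n ⊕ Fin n) (Fin n ⊕ Fin n) K :=
  fromBlocks (A - g⁻¹ • vecMulVec b c) (g⁻¹ • vecMulVec b b) (-Q - g⁻¹ • vecMulVec c c)
    (-Aᵀ + g⁻¹ • vecMulVec c b)

lemma ham_apply (A Q : Matrix (Fin n) (Fin n) K) (b c : Fin n → K) (g : K) (x y : Fin n → K) :
    Ham A Q b c g *ᵥ (Sum.elim x y) =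
      Sum.elim (A *ᵥ x + (g⁻¹ * (b ⬝ᵥ y - c ⬝ᵥ x)) • b)
        (-(Q *ᵥ x) - Aᵀ *ᵥ y + (g⁻¹ * (b ⬝ᵥ y - c ⬝ᵥ x)) • c) := by
  rw [Ham, Matrix.fromBlocks_mulVec]
  simp only [Sum.elim_comp_inl, Sum.elim_comp_inr, Matrix.sub_mulVec, Matrix.add_mulVec,
    Matrix.neg_mulVec, Matrix.smul_mulVec, Matrix.vecMulVec_mulVec]
  congr 1 <;> ext i <;> simp <;> ring

lemma ham_map (A Q : Matrix (Fin n) (Fin n) ℝ) (b c : Fin n → ℝ) (g : ℝ) :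
    (Ham A Q b c g).map (algebraMap ℝ ℂ) =
      Ham (A.map (algebraMap ℝ ℂ)) (Q.map (algebraMap ℝ ℂ)) (fun i => (b i : ℂ)) (fun i => (c i : ℂ))
        (g : ℂ) := by
  ext i j
  rcases i with i | i <;> rcases j with j | j <;> simp [Ham, vecMulVec_apply]

def symp (n : ℕ) : (Fin n ⊕ Fin n → ℝ) →ₗ[ℝ] (Fin n ⊕ Fin n → ℝ) →ₗ[ℝ] ℝ :=
  LinearMap.mk₂ ℝ (fun z w => (z ∘ Sum.inl) ⬝ᵥ (w ∘ Sum.inr) - (z ∘ Sum.inr) ⬝ᵥ (w ∘ Sum.inl))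
    (by intro a b c; simp only [dotProduct, Function.comp, Pi.add_apply, add_mul, Finset.sum_add_distrib]; ring)
    (by intro a b c; simp only [dotProduct, Function.comp, Pi.smul_apply, smul_eq_mul, mul_assoc, ← Finset.mul_sum]; ring)
    (by intro a b c; simp only [dotProduct, Function.comp, Pi.add_apply, mul_add, Finset.sum_add_distrib]; ring)
    (by intro a b c; simp only [dotProduct, Function.comp, Pi.smul_apply, smul_eq_mul, mul_left_comm _ a, ← Finset.mul_sum]; ring)

lemma symp_elim (x y x' y' : Fin n → ℝ) :
    symp n (Sum.elim x y) (Sum.elim x' y') = x ⬝ᵥ y' - y ⬝ᵥ x' := rfl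

lemma symp_inj : Function.Injective (symp n) := by
  rw [← LinearMap.ker_eq_bot, LinearMap.ker_eq_bot']
  intro z hz
  obtain ⟨x, y, rfl⟩ : ∃ x y, z = Sum.elim x y := ⟨z ∘ Sum.inl, z ∘ Sum.inr, by simp⟩
  have h1 := LinearMap.congr_fun hz (Sum.elim (-y) x)
  rw [symp_elim] at h1
  simp at h1
  have hx : 0 ≤ x ⬝ᵥ x := by simpa using dotProduct_star_self_nonneg x
  have hy : 0 ≤ y ⬝ᵥ y := by simpa using dotProduct_star_self_nonneg y
  have hx0 : x = 0 := dotProduct_self_eq_zero.mp (by linarith)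
  have hy0 : y = 0 := dotProduct_self_eq_zero.mp (by linarith)
  rw [hx0, hy0]; simp

lemma symp_skew (A Q : Matrix (Fin n) (Fin n) ℝ) (b c : Fin n → ℝ) (g : ℝ) (hg : g ≠ 0)
    (hQ : Qᵀ = Q) (z w : Fin n ⊕ Fin n → ℝ) :
    symp n (Matrix.toLin' (Ham A Q b c g) z) w = - symp n z (Matrix.toLin' (Ham A Q b c g) w) := by
  obtain ⟨x, y, rfl⟩ : ∃ x y, z = Sum.elim x y := ⟨z ∘ Sum.inl, z ∘ Sum.inr, by simp⟩
  obtain ⟨x', y', rfl⟩ : ∃ x y, w = Sum.elim x y := ⟨w ∘ Sum.inl, w ∘ Sum.inr, by simp⟩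
  rw [Matrix.toLin'_apply, Matrix.toLin'_apply, ham_apply, ham_apply, symp_elim, symp_elim]
  simp only [add_dotProduct, sub_dotProduct, neg_dotProduct, dotProduct_add, dotProduct_sub,
    dotProduct_neg, smul_dotProduct, dotProduct_smul, smul_eq_mul]
  have e1 : (Aᵀ *ᵥ y) ⬝ᵥ x' = y ⬝ᵥ (A *ᵥ x') := by
    rw [Matrix.mulVec_transpose, Matrix.dotProduct_mulVec]
  have e2 : x ⬝ᵥ (Aᵀ *ᵥ y') = (A *ᵥ x) ⬝ᵥ y' := by
    rw [Matrix.dotProduct_mulVec, Matrix.vecMul_transpose]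
  have e3 : (Q *ᵥ x) ⬝ᵥ x' = x ⬝ᵥ (Q *ᵥ x') := by
    rw [Matrix.dotProduct_mulVec, ← Matrix.mulVec_transpose, hQ]
  rw [e1, e2, e3, dotProduct_comm x c, dotProduct_comm y b]
  field_simp
  ring

lemma noimag (A φ : Matrix (Fin n) (Fin n) ℝ) (b c : Fin n → ℝ) (γ ε : ℝ) (hγ : 0 < γ)
    (hH : ∀ μ : ℂ, ((A.map (algebraMap ℝ ℂ)).charpoly).IsRoot μ → μ.re < 0)
    (hε : ∀ ω : ℝ, ∀ x : Fin n → ℂ, x = (((Complex.I * (ω : ℂ)) • (1 : Matrix (Fin n) (Fin n) ℂ)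
            - A.map (algebraMap ℝ ℂ))⁻¹.mulVec (fun i => (b i : ℂ))) →
      ε * (star x ⬝ᵥ (φ.map (algebraMap ℝ ℂ) *ᵥ x)).re <
        γ + 2 * ((fun i => (c i : ℂ)) ⬝ᵥ x).re)
    (z : ℂ) (hz : aeval z (Ham A (ε • φ) b c γ).charpoly = 0) : z.re ≠ 0 := by
  intro hre
  set Ac := A.map (algebraMap ℝ ℂ) with hAc
  set φc := φ.map (algebraMap ℝ ℂ) with hφc
  set bc : Fin n → ℂ := fun i => (b i : ℂ) with hbc
  set cc : Fin n → ℂ := fun i => (c i : ℂ) with hcc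
  have hQ : (ε • φ).map (algebraMap ℝ ℂ) = (ε : ℂ) • φc := by ext i j; simp [hφc]
  have hγc : (γ : ℂ) ≠ 0 := by exact_mod_cast hγ.ne'
  have hzω : z = Complex.I * (z.im : ℂ) := by apply Complex.ext <;> simp [hre]
  have hroot : ((Ham A (ε • φ) b c γ).map (algebraMap ℝ ℂ)).charpoly.eval z = 0 := by
    rw [Matrix.charpoly_map, Polynomial.eval_map_algebraMap, hz]
  rw [ham_map, hQ, ← hAc, ← hbc, ← hcc, Matrix.eval_charpoly, ← Matrix.exists_mulVec_eq_zero_iff] at hroot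
  obtain ⟨v, hv, hzv⟩ := hroot
  obtain ⟨x, y, rfl⟩ : ∃ x y, v = Sum.elim x y := ⟨v ∘ Sum.inl, v ∘ Sum.inr, by simp⟩
  rw [Matrix.sub_mulVec, sub_eq_zero, Matrix.scalar_apply, ← Matrix.smul_one_eq_diagonal, Matrix.smul_mulVec,
    Matrix.one_mulVec, ham_apply] at hzv
  set u := (γ : ℂ)⁻¹ * (bc ⬝ᵥ y - cc ⬝ᵥ x) with hu
  have E1 : z • x = Ac *ᵥ x + u • bc := by
    ext i; simpa using congrFun hzv (Sum.inl i)
  have E2 : z • y = -(((ε : ℂ) • φc) *ᵥ x) - Acᵀ *ᵥ y + u • cc := by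
    ext i; simpa using congrFun hzv (Sum.inr i)
  have hd1 := det_ne A hH z hre.ge
  rw [← hAc] at hd1
  have hx : x = u • ((z • (1 : Matrix (Fin n) (Fin n) ℂ) - Ac)⁻¹ *ᵥ bc) := by
    have : (z • (1 : Matrix (Fin n) (Fin n) ℂ) - Ac) *ᵥ x = u • bc := by
      rw [Matrix.sub_mulVec, Matrix.smul_mulVec, Matrix.one_mulVec, E1]; abel
    rw [← Matrix.mulVec_smul, ← this, Matrix.mulVec_mulVec,
      Matrix.nonsing_inv_mul _ (isUnit_iff_ne_zero.mpr hd1), Matrix.one_mulVec]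
  by_cases hu0 : u = 0
  · rw [hu0, zero_smul] at hx
    rw [hx, hu0] at E2
    simp at E2
    apply hv
    have hy : y = 0 := by
      by_contra hy0
      have hd2 := det_ne A hH (-z) (by simp [hre])
      rw [← Matrix.det_transpose] at hd2
      apply hd2
      rw [← Matrix.exists_mulVec_eq_zero_iff]
      refine ⟨y, hy0, ?_⟩
      rw [Matrix.transpose_sub, Matrix.transpose_smul, Matrix.transpose_one, Matrix.sub_mulVec,
        Matrix.smul_mulVec, Matrix.one_mulVec, neg_smul, E2, ← hAc]
      simp
    rw [hx, hy]; simp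
  · set r := (z • (1 : Matrix (Fin n) (Fin n) ℂ) - Ac)⁻¹ *ᵥ bc with hr
    obtain ⟨s, hs⟩ : ∃ s, y = u • s := ⟨u⁻¹ • y, by rw [smul_smul, mul_inv_cancel₀ hu0, one_smul]⟩
    have F1 : z • r = Ac *ᵥ r + bc := by
      have : (z • (1 : Matrix (Fin n) (Fin n) ℂ) - Ac) *ᵥ r = bc := by
        rw [hr, Matrix.mulVec_mulVec, Matrix.mul_nonsing_inv _ (isUnit_iff_ne_zero.mpr hd1), Matrix.one_mulVec]
      rw [Matrix.sub_mulVec, Matrix.smul_mulVec, Matrix.one_mulVec] at this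
      rw [← this]; abel
    have F2 : z • s = -((ε : ℂ) • (φc *ᵥ r)) - Acᵀ *ᵥ s + cc := by
      have h1 : u • (z • s) = u • (-((ε : ℂ) • (φc *ᵥ r)) - Acᵀ *ᵥ s + cc) := by
        rw [smul_comm u z s, ← hs, E2, hx, hs, Matrix.smul_mulVec, Matrix.mulVec_smul, Matrix.mulVec_smul,
          smul_add, smul_sub, smul_neg, smul_comm u (ε : ℂ)]
      exact smul_right_injective _ hu0 h1
    have F3 : bc ⬝ᵥ s - cc ⬝ᵥ r = γ := by
      rw [hs, hx] at hu
      simp only [dotProduct_smul, smul_eq_mul] at hu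
      have h2 : u * (bc ⬝ᵥ s - cc ⬝ᵥ r) = u * γ := by
        field_simp at hu
        rw [mul_sub, ← mul_sub]
        linear_combination -u * hu
      exact mul_left_cancel₀ hu0 h2
    have hlt := hε z.im r (by rw [← hzω])
    have G1 : star r ⬝ᵥ (Acᵀ *ᵥ s) = -z * (star r ⬝ᵥ s) - bc ⬝ᵥ s := by
      have h1 : star r ⬝ᵥ (Acᵀ *ᵥ s) = star (Ac *ᵥ r) ⬝ᵥ s := by
        have h5 : Acᴴ = Acᵀ := by
          ext i j; simp [hAc]
        rw [Matrix.dotProduct_mulVec, Matrix.star_mulVec Ac r, h5]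
      have h2 : Ac *ᵥ r = z • r - bc := by rw [F1]; abel
      have h3 : star bc = bc := by ext i; simp [hbc]
      have h4 : star z = -z := by apply Complex.ext <;> simp [hre]
      rw [h1, h2, star_sub, star_smul, h3, h4, sub_dotProduct, smul_dotProduct, smul_eq_mul]
    have G2 := congrArg (fun w => star r ⬝ᵥ w) F2
    simp only [dotProduct_add, dotProduct_sub, dotProduct_neg, dotProduct_smul, smul_eq_mul] at G2
    rw [G1] at G2
    have G3 : star r ⬝ᵥ cc = star (cc ⬝ᵥ r) := by
      have h3 : star cc = cc := by ext i; simp [hcc]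
      rw [← Matrix.star_dotProduct_star, h3]
    rw [G3] at G2
    have G4 : (ε : ℂ) * (star r ⬝ᵥ (φc *ᵥ r)) = γ + cc ⬝ᵥ r + star (cc ⬝ᵥ r) := by
      linear_combination G2 + F3
    have G5 := congrArg Complex.re G4
    simp at G5
    linarith

lemma riccati (A Q : Matrix (Fin n) (Fin n) ℝ) (b c : Fin n → ℝ) (γ : ℝ) (hγ : 0 < γ)
    (hH : ∀ μ : ℂ, ((A.map (algebraMap ℝ ℂ)).charpoly).IsRoot μ → μ.re < 0)
    (hQ : Qᵀ = Q)
    (him : ∀ z : ℂ, aeval z (Ham A Q b c γ).charpoly = 0 → z.re ≠ 0) :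
    ∃ P : Matrix (Fin n) (Fin n) ℝ, Pᵀ = P ∧
      Aᵀ * P + P * A + γ⁻¹ • vecMulVec (P *ᵥ b - c) (P *ᵥ b - c) + Q = 0 := by
  obtain ⟨p, q, hpq, hp, hq⟩ := factor _ (Matrix.charpoly_monic _).ne_zero him
  set T := Matrix.toLin' (Ham A Q b c γ) with hT
  set V := LinearMap.ker (aeval T p) with hV
  set W := LinearMap.ker (aeval T q) with hW
  have hcop : IsCoprime p q := coprime_of fun z h1 h2 => by linarith [hp z h1, hq z h2]
  have hVW : V ⊔ W = ⊤ := by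
    rw [hV, hW, Polynomial.sup_ker_aeval_eq_ker_aeval_mul_of_coprime T hcop, ← hpq,
      ← Matrix.charpoly_toLin', LinearMap.aeval_self_charpoly, LinearMap.ker_zero]
  have hdis : V ⊓ W = ⊥ := disjoint_iff.mp (Polynomial.disjoint_ker_aeval_of_isCoprime T hcop)
  have hdim : Module.finrank ℝ V + Module.finrank ℝ W = 2 * n := by
    have := Submodule.finrank_sup_add_finrank_inf_eq V W
    rw [hVW, hdis] at this
    simp at this
    omega
  have hskew := symp_skew A Q b c γ hγ.ne' hQ
  have hVi : ∀ z ∈ V, ∀ w ∈ V, symp n z w = 0 := fun z hz w hw =>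
    isotropic T (symp n) hskew p
      (coprime_neg fun z w h1 h2 => mul_pos_of_neg_of_neg (hp z h1) (hp w h2)) z w hz hw
  have hWi : ∀ z ∈ W, ∀ w ∈ W, symp n z w = 0 := fun z hz w hw =>
    isotropic T (symp n) hskew q
      (coprime_neg fun z w h1 h2 => mul_pos (hq z h1) (hq w h2)) z w hz hw
  have hWd := isotropic_finrank (symp n) symp_inj W hWi
  have hE : Module.finrank ℝ (Fin n ⊕ Fin n → ℝ) = 2 * n := by simp; omega
  rw [hE] at hWd
  have hVinv : ∀ z ∈ V, T z ∈ V := by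
    intro z hz
    rw [hV, LinearMap.mem_ker] at hz ⊢
    have : aeval T p (T z) = T (aeval T p z) := by
      have h1 : aeval T p * T = T * aeval T p := by
        have h2 : aeval T (p * X) = aeval T (X * p) := by rw [mul_comm]
        simpa only [map_mul, aeval_X] using h2
      exact LinearMap.congr_fun h1 z
    rw [this, hz, map_zero]
  -- vertical part is trivial
  have hY : ∀ y : Fin n → ℝ, Sum.elim (0 : Fin n → ℝ) y ∈ V → b ⬝ᵥ y = 0 ∧ T (Sum.elim (0 : Fin n → ℝ) y) = Sum.elim (0 : Fin n → ℝ) (-(Aᵀ *ᵥ y)) := by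
    intro y hy
    have h1 := hVi _ hy _ (hVinv _ hy)
    have h2 : T (Sum.elim (0 : Fin n → ℝ) y) = Sum.elim ((γ⁻¹ * (b ⬝ᵥ y)) • b) (-(Aᵀ *ᵥ y) + (γ⁻¹ * (b ⬝ᵥ y)) • c) := by
      rw [hT, Matrix.toLin'_apply, ham_apply]; simp
    rw [h2, symp_elim] at h1
    have h3 : b ⬝ᵥ y = 0 := by
      simp [dotProduct_comm y b, hγ.ne'] at h1
      exact h1
    refine ⟨h3, ?_⟩
    rw [h2, h3]; simp
  have hY0 : ∀ y : Fin n → ℝ, Sum.elim (0 : Fin n → ℝ) y ∈ V → y = 0 := by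
    intro y hy
    set S : Module.End ℝ (Fin n → ℝ) := -(Matrix.toLin' Aᵀ) with hS
    have hpow : ∀ k : ℕ, (T ^ k) (Sum.elim (0 : Fin n → ℝ) y) = Sum.elim (0 : Fin n → ℝ) ((S ^ k) y) ∧
        (T ^ k) (Sum.elim (0 : Fin n → ℝ) y) ∈ V := by
      intro k
      induction k with
      | zero => simpa using hy
      | succ k ih =>
        obtain ⟨ih1, ih2⟩ := ih
        refine ⟨?_, ?_⟩
        · rw [pow_succ', pow_succ', Module.End.mul_apply, Module.End.mul_apply, ih1]
          rw [ih1] at ih2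
          rw [(hY _ ih2).2, hS]; simp
        · rw [pow_succ', Module.End.mul_apply]
          exact hVinv _ ih2
    have hpoly : ∀ f : ℝ[X], aeval T f (Sum.elim (0 : Fin n → ℝ) y) = Sum.elim (0 : Fin n → ℝ) (aeval S f y) := by
      intro f
      induction f using Polynomial.induction_on' with
      | add f g hf hg => simp [hf, hg, ← Sum.elim_add_add]
      | monomial k a =>
        simp only [aeval_monomial, Module.End.mul_apply, Module.algebraMap_end_apply, (hpow k).1]
        ext i
        rcases i with i | i <;> simp
    have hpS : aeval S p y = 0 := by
      have h1 : aeval T p (Sum.elim (0 : Fin n → ℝ) y) = 0 := hy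
      rw [hpoly] at h1
      ext i
      simpa using congrFun h1 (Sum.inr i)
    have hcop2 : IsCoprime (p.comp (-X)) A.charpoly := by
      refine coprime_of fun z h1 h2 => ?_
      have h3 : aeval (-z) p = 0 := by
        rw [aeval_comp] at h1
        simpa using h1
      have h4 := hp _ h3
      have h5 : z.re < 0 := by
        apply hH
        rw [Polynomial.IsRoot.def, Matrix.charpoly_map, Polynomial.eval_map_algebraMap, h2]
      simp at h4
      linarith
    have h6 : aeval (Matrix.toLin' Aᵀ) (p.comp (-X)) y = 0 := by
      rw [aeval_comp]
      simpa [hS] using hpS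
    have h7 : aeval (Matrix.toLin' Aᵀ) A.charpoly y = 0 := by
      rw [← Matrix.charpoly_transpose, ← Matrix.charpoly_toLin', LinearMap.aeval_self_charpoly]
      simp
    have h8 := (Polynomial.disjoint_ker_aeval_of_isCoprime (Matrix.toLin' Aᵀ) hcop2)
    exact Submodule.disjoint_def.mp h8 y h6 h7
  -- the graph
  let π : V →ₗ[ℝ] (Fin n → ℝ) := (LinearMap.funLeft ℝ ℝ Sum.inl).comp V.subtype
  let π' : V →ₗ[ℝ] (Fin n → ℝ) := (LinearMap.funLeft ℝ ℝ Sum.inr).comp V.subtype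
  have hπ : Function.Injective π := by
    rw [← LinearMap.ker_eq_bot, LinearMap.ker_eq_bot']
    rintro ⟨z, hz⟩ h0
    have h1 : z ∘ Sum.inl = 0 := h0
    have h2 : z = Sum.elim (0 : Fin n → ℝ) (z ∘ Sum.inr) := by rw [← h1]; simp
    have h3 := hY0 (z ∘ Sum.inr) (by rw [← h2]; exact hz)
    rw [h3] at h2
    ext i
    simp [h2]
  have hVle := LinearMap.finrank_le_finrank_of_injective hπ
  rw [Module.finrank_fin_fun] at hVle
  have hVn : Module.finrank ℝ V = Module.finrank ℝ (Fin n → ℝ) := by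
    rw [Module.finrank_fin_fun]; omega
  have hπs : Function.Surjective π :=
    (LinearMap.injective_iff_surjective_of_finrank_eq_finrank hVn).mp hπ
  let e := LinearEquiv.ofBijective π ⟨hπ, hπs⟩
  let P : Matrix (Fin n) (Fin n) ℝ := LinearMap.toMatrix' (π'.comp e.symm.toLinearMap)
  have hPV : ∀ x, Sum.elim x (P *ᵥ x) ∈ V := by
    intro x
    have h1 : P *ᵥ x = π' (e.symm x) := by
      rw [← Matrix.toLin'_apply, Matrix.toLin'_toMatrix']; rfl
    have h2 : x = π (e.symm x) := (e.apply_symm_apply x).symm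
    have h3 : Sum.elim x (P *ᵥ x) = (e.symm x : Fin n ⊕ Fin n → ℝ) := by
      rw [h1]
      nth_rewrite 1 [h2]
      ext i
      rcases i with i | i <;> rfl
    rw [h3]
    exact (e.symm x).2
  have hPu : ∀ x y, Sum.elim x y ∈ V → y = P *ᵥ x := by
    intro x y hxy
    have h1 := V.sub_mem hxy (hPV x)
    rw [← Sum.elim_sub_sub, sub_self] at h1
    exact sub_eq_zero.mp (hY0 _ h1)
  have hPs : Pᵀ = P := by
    have hd : ∀ x x' : Fin n → ℝ, x ⬝ᵥ (P *ᵥ x') = (P *ᵥ x) ⬝ᵥ x' := by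
      intro x x'
      have := hVi _ (hPV x) _ (hPV x')
      rw [symp_elim] at this
      linarith
    ext i j
    have := hd (Pi.single j 1) (Pi.single i 1)
    simpa using this
  refine ⟨P, hPs, ?_⟩
  refine Matrix.toLin'.injective (LinearMap.ext fun x => ?_)
  have h1 := hVinv _ (hPV x)
  rw [hT, Matrix.toLin'_apply, ham_apply] at h1
  have h2 := hPu _ _ h1
  have h3 : (P *ᵥ b - c) ⬝ᵥ x = b ⬝ᵥ (P *ᵥ x) - c ⬝ᵥ x := by
    rw [sub_dotProduct, Matrix.dotProduct_mulVec, ← Matrix.mulVec_transpose, hPs]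
  rw [Matrix.mulVec_add, Matrix.mulVec_smul] at h2
  simp only [Matrix.toLin'_apply, Matrix.add_mulVec, Matrix.smul_mulVec, Matrix.vecMulVec_mulVec, h3,
    ← Matrix.mulVec_mulVec, Matrix.zero_mulVec, map_zero, LinearMap.zero_apply]
  ext i
  have h4 := congrFun h2 i
  simp at h4 ⊢
  linarith
end
end MKY

/-- Meyer–Kalman–Yakubovich (MKY) lemma (Lemma 2): if `A` is Hurwitz and the
transfer function `W(s) = cᵀ(sI − A)⁻¹b` satisfies
`Re{γ/2 + W(iω)} > 0` for all `ω`, then there exist `ε > 0`, a vector `α`, and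
a symmetric positive definite `P` with `AᵀP + PA = −ααᵀ − εφ` and
`Pb − c = √γ α`. -/
theorem stmt_10 (n : ℕ) (A : Matrix (Fin n) (Fin n) ℝ) (b c : Fin n → ℝ)
    (γ : ℝ) (hγ : 0 < γ) (φ : Matrix (Fin n) (Fin n) ℝ) (hφ : φ.PosDef)
    (hHurwitz : ∀ μ : ℂ, ((A.map (algebraMap ℝ ℂ)).charpoly).IsRoot μ → μ.re < 0)
    (hSPR : ∀ ω : ℝ,
      0 < ((γ : ℂ) / 2 + (fun i => (c i : ℂ)) ⬝ᵥ
        (((Complex.I * (ω : ℂ)) • (1 : Matrix (Fin n) (Fin n) ℂ)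
            - A.map (algebraMap ℝ ℂ))⁻¹.mulVec (fun i => (b i : ℂ)))).re) :
    ∃ ε > (0 : ℝ), ∃ α : Fin n → ℝ, ∃ P : Matrix (Fin n) (Fin n) ℝ,
      P.PosDef
      ∧ Aᵀ * P + P * A = -(Matrix.vecMulVec α α) - ε • φ
      ∧ P.mulVec b - c = Real.sqrt γ • α := by
  obtain ⟨ε, hε, hε2⟩ := MKY.exists_eps A b c γ hγ φ hHurwitz hSPR
  have hφt : φᵀ = φ := by
    have := hφ.isHermitian
    rwa [Matrix.IsHermitian, Matrix.conjTranspose_eq_transpose_of_trivial] at this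
  obtain ⟨P, hPs, hP⟩ := MKY.riccati A (ε • φ) b c γ hγ hHurwitz
    (by rw [Matrix.transpose_smul, hφt])
    (MKY.noimag A φ b c γ ε hγ hHurwitz hε2)
  have hs : Real.sqrt γ ≠ 0 := (Real.sqrt_pos.mpr hγ).ne'
  set α : Fin n → ℝ := (Real.sqrt γ)⁻¹ • (P *ᵥ b - c) with hα
  have hαα : vecMulVec α α = γ⁻¹ • vecMulVec (P *ᵥ b - c) (P *ᵥ b - c) := by
    rw [hα, Matrix.smul_vecMulVec, Matrix.vecMulVec_smul, smul_smul, ← mul_inv, Real.mul_self_sqrt hγ.le]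
  have heq : Aᵀ * P + P * A = -(vecMulVec α α) - ε • φ := by
    rw [hαα, sub_eq_add_neg, ← neg_add]
    exact eq_neg_of_add_eq_zero_left (by rw [← add_assoc]; exact hP)
  refine ⟨ε, hε, α, P, ?_, heq, ?_⟩
  · refine MKY.lyap A P (vecMulVec α α + ε • φ) hHurwitz hPs ?_ (by rw [heq]; abel)
    refine Matrix.PosDef.posSemidef_add ?_ (hφ.smul hε)
    simpa using Matrix.posSemidef_vecMulVec_self_star α
  · rw [hα, smul_smul, mul_inv_cancel₀ hs, one_smul]
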